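/- Let $T \in \mathfrak{P}_n$ and suppose $T$ has at least one completion in the homeomorphism group of $\mathfrak{C}_n$. Then the group $\mathcal{H}(T)$ is flexible: for every pair $E_1, E_2$ of proper nonempty clopen subsets of $\mathfrak{C}_n$ there is $f \in \mathcal{H}(T)$ with $(E_1)f \subset E_2$. -/

import Mathlib

open Classical

noncomputable section

/-- `n`-ary Cantor space: infinite words over the alphabet `Fin n`. -/
abbrev Cantor (n : ℕ) : Type := ℕ → Fin n

/-- The finite word `w` is a prefix of the infinite word `χ`. -/
def PrefixOf {n : ℕ} (w : List (Fin n)) (χ : Cantor n) : Prop :=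
  ∀ (i : ℕ) (h : i < w.length), w.get ⟨i, h⟩ = χ i

/-- Concatenation of a finite word with an infinite word. -/
def appendInf {n : ℕ} (w : List (Fin n)) (χ : Cantor n) : Cantor n :=
  fun i => if h : i < w.length then w.get ⟨i, h⟩ else χ (i - w.length)

/-- The cone (basic clopen set) of infinite words having the finite word `w` as prefix. -/
def cone {n : ℕ} (w : List (Fin n)) : Set (Cantor n) :=
  {χ | PrefixOf w χ}

/-- The length-`k` prefix of an infinite word, as a finite word. -/
def takeW {n : ℕ} (χ : Cantor n) (k : ℕ) : List (Fin n) :=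
  List.ofFn (fun i : Fin k => χ i)

/-- A finite family of finite words forming a maximal antichain:
every infinite word has exactly one member of the family as a prefix. -/
def AntichainFam {n m : ℕ} (α : Fin m → List (Fin n)) : Prop :=
  ∀ χ : Cantor n, ∃! i : Fin m, PrefixOf (α i) χ

/-- The group structure on self-homeomorphisms of a topological space,
with `f * g` acting as `g` followed by `f`. -/
instance homeoGroup {X : Type*} [TopologicalSpace X] : Group (X ≃ₜ X) where
  mul f g := g.trans f
  one := Homeomorph.refl X
  inv := Homeomorph.symm
  mul_assoc a b c := Homeomorph.ext fun _ => rfl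
  one_mul a := Homeomorph.ext fun _ => rfl
  mul_one a := Homeomorph.ext fun _ => rfl
  inv_mul_cancel a := Homeomorph.ext fun x => a.symm_apply_apply x

/-- The Higman–Thompson group `Vₙ`, as the set of self-homeomorphisms of Cantor space
which act by exchanging finite prefixes along a pair of maximal antichains. -/
def Vn (n : ℕ) : Set (Cantor n ≃ₜ Cantor n) :=
  {g | ∃ (m : ℕ) (α β : Fin m → List (Fin n)), AntichainFam α ∧ AntichainFam β ∧
      ∀ (i : Fin m) (χ : Cantor n), g (appendInf (α i) χ) = appendInf (β i) χ}

/-- Conjugation in the paper's right-action convention: `paperConj g v = g⁻¹ v g`,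
i.e. the homeomorphism `x ↦ (x) g⁻¹ v g` (first apply `g⁻¹`, then `v`, then `g`). -/
def paperConj {n : ℕ} (g v : Cantor n ≃ₜ Cantor n) : Cantor n ≃ₜ Cantor n :=
  (g.symm.trans v).trans g

/-- `l` is the longest common prefix of the set `A` of infinite words. -/
def IsLCP {n : ℕ} (A : Set (Cantor n)) (l : List (Fin n)) : Prop :=
  (∀ ρ ∈ A, PrefixOf l ρ) ∧
    ∀ l' : List (Fin n), (∀ ρ ∈ A, PrefixOf l' ρ) → l'.length ≤ l.length

/-- A (not necessarily finite-state) transducer over the alphabet `Fin n`. -/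
structure Transducer (n : ℕ) where
  /-- the set of states -/
  Q : Type
  /-- the transition function -/
  tr : Fin n → Q → Q
  /-- the output (rewrite) function -/
  out : Fin n → Q → List (Fin n)

namespace Transducer

variable {n : ℕ}

/-- The transition function extended to finite words. -/
def transStar (T : Transducer n) : List (Fin n) → T.Q → T.Q
  | [], q => q
  | x :: w, q => T.transStar w (T.tr x q)

/-- The output function extended to finite words. -/
def outStar (T : Transducer n) : List (Fin n) → T.Q → List (Fin n)
  | [], _ => []
  | x :: w, q => T.out x q ++ T.outStar w (T.tr x q)

/-- The initial transducer `T_q` induces the map `f` on Cantor space: the outputs along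
ever longer prefixes of `χ` are ever longer prefixes of `f χ`. -/
def Induces (T : Transducer n) (q : T.Q) (f : Cantor n → Cantor n) : Prop :=
  ∀ (χ : Cantor n) (m : ℕ), ∃ k : ℕ,
    m ≤ (T.outStar (takeW χ k) q).length ∧ PrefixOf (T.outStar (takeW χ k) q) (f χ)

/-- The image of the state `q`: the image of Cantor space under the map induced by `T_q`. -/
def stateImage (T : Transducer n) (q : T.Q) : Set (Cantor n) :=
  {y | ∃ (f : Cantor n → Cantor n) (χ : Cantor n), T.Induces q f ∧ f χ = y}

/-- `T` is synchronizing at level `k`: the state reached after reading any word of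
length `k` does not depend on the starting state. -/
def SyncAtLevel (T : Transducer n) (k : ℕ) : Prop :=
  ∀ w : List (Fin n), w.length = k → ∀ q q' : T.Q, T.transStar w q = T.transStar w q'

/-- `T` is synchronizing if it is synchronizing at some level. -/
def Synchronizing (T : Transducer n) : Prop := ∃ k, T.SyncAtLevel k

/-- `T` (inducing the homeomorphism `h` at `q0`) is one-way synchronizing: `T` is
synchronizing, but the inverse homeomorphism is not induced by any finite
synchronizing transducer (equivalently, the inverse transducer is not synchronizing). -/
def OneWaySync (T : Transducer n) (q0 : T.Q) (h : Cantor n ≃ₜ Cantor n) : Prop :=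
  T.Induces q0 ⇑h ∧ T.Synchronizing ∧
    ¬ ∃ (S : Transducer n) (_ : Finite S.Q) (s0 : S.Q),
        S.Induces s0 ⇑h.symm ∧ S.Synchronizing

/-- `T` is equal to its core : every state is reached by reading a word of length `k`
from some state, for every synchronizing level `k`. -/
def EqualToCore (T : Transducer n) : Prop :=
  ∀ k : ℕ, T.SyncAtLevel k → ∀ q : T.Q, ∃ (w : List (Fin n)) (p : T.Q),
    w.length = k ∧ T.transStar w p = q

/-- Every state of `T` is accessible from `q0`. -/
def Accessible (T : Transducer n) (q0 : T.Q) : Prop :=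
  ∀ q : T.Q, ∃ w : List (Fin n), T.transStar w q0 = q

/-- The product transducer `T S` (first act by `T`, then by `S`). -/
def prod (T S : Transducer n) : Transducer n where
  Q := T.Q × S.Q
  tr := fun x p => (T.tr x p.1, S.transStar (T.out x p.1) p.2)
  out := fun x p => S.outStar (T.out x p.1) p.2

/-- `T` is partially invertible: every state induces an injective map on Cantor space
with clopen image. -/
def PartiallyInvertible (T : Transducer n) : Prop :=
  ∀ q : T.Q, ∃ f : Cantor n → Cantor n,
    T.Induces q f ∧ Function.Injective f ∧ IsClopen (Set.range f)

/-- `T` has no states of incomplete response: for each state `q` and letter `i`, no word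
strictly longer than `λ(i,q)` is a common prefix of the outputs on all of the cone `[i]`. -/
def NoIncompleteResponse (T : Transducer n) : Prop :=
  ∀ (q : T.Q) (i x : Fin n),
    ¬ ∀ χ : Cantor n, ∃ k : ℕ, (T.out i q ++ [x]) <+: T.outStar (i :: takeW χ k) q

/-- States `q` of `T` and `p` of `S` are `ω`-equivalent: they induce one and the same
map on Cantor space. -/
def OmegaEq (T : Transducer n) (q : T.Q) (S : Transducer n) (p : S.Q) : Prop :=
  ∃ f : Cantor n → Cantor n, T.Induces q f ∧ S.Induces p f

/-- `T` is minimal: no states of incomplete response and no pair of distinct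
`ω`-equivalent states. -/
def Minimal (T : Transducer n) : Prop :=
  T.NoIncompleteResponse ∧ ∀ q q' : T.Q, T.OmegaEq q T q' → q = q'

/-- The map on Cantor space induced by the state `q` (junk value if none exists). -/
def inducedMap (T : Transducer n) (q : T.Q) : Cantor n → Cantor n :=
  if h : ∃ f, T.Induces q f then h.choose else id

/-- `𝓛_q(α)`: the longest common prefix of the preimage of the cone `[α]` under `T_q`
(junk value if it does not exist). -/
def lcp (T : Transducer n) (q : T.Q) (α : List (Fin n)) : List (Fin n) :=
  if h : ∃ l, IsLCP {ρ : Cantor n | T.inducedMap q ρ ∈ cone α} l then h.choose else []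

/-- The inverse transducer of `T` given by the inversion algorithm, on the set of all
pairs `(w, q)`: reading `x` from `(w,q)` outputs `𝓛_q(wx)` and moves to
`(wx - λ(𝓛_q(wx), q), π(𝓛_q(wx), q))`. -/
def invT (T : Transducer n) : Transducer n where
  Q := List (Fin n) × T.Q
  tr := fun x p =>
    ((p.1 ++ [x]).drop (T.outStar (T.lcp p.2 (p.1 ++ [x])) p.2).length,
      T.transStar (T.lcp p.2 (p.1 ++ [x])) p.2)
  out := fun x p => T.lcp p.2 (p.1 ++ [x])

/-- Restriction of a transducer to a set of states (transitions leaving the set are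
replaced by junk loops; for transition-closed sets this is the honest restriction). -/
def restrictTo (T : Transducer n) (P : T.Q → Prop) : Transducer n where
  Q := {q : T.Q // P q}
  tr := fun x q => if h : P (T.tr x q.1) then ⟨T.tr x q.1, h⟩ else q
  out := fun x q => T.out x q.1

/-- The set of states reachable from `q0`. -/
def reach (T : Transducer n) (q0 : T.Q) : T.Q → Prop :=
  fun q => ∃ w : List (Fin n), T.transStar w q0 = q

/-- The inverse transducer of the initial transducer `T_{q0}`, with state set the states
accessible from `(ε, q0)`. -/
def invAcc (T : Transducer n) (q0 : T.Q) : Transducer n :=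
  (T.invT).restrictTo ((T.invT).reach ([], q0))

/-- A pair `(w,p)` is good if `[w] ⊆ im(T_p)` and `𝓛_p(w) = ε`. -/
def GoodPair (T : Transducer n) (p : List (Fin n) × T.Q) : Prop :=
  cone p.1 ⊆ T.stateImage p.2 ∧
    IsLCP {ρ : Cantor n | T.inducedMap p.2 ρ ∈ cone p.1} []

/-- The partial inverse `T'` of a partially invertible transducer `T`: the inverse
transducer restricted to the good pairs `(w,p)` with `[w] ⊆ im(T_p)`, `𝓛_p(w) = ε`. -/
def partialInv (T : Transducer n) : Transducer n :=
  (T.invT).restrictTo T.GoodPair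

/-- `h` is a completion of `T`: there are a maximal antichain `η` and an effective viable
combination `(ρ, p)` such that `h` maps `η_i χ` to `ρ_i (χ)T_{p_i}`. -/
def IsCompletion (T : Transducer n) (h : Cantor n ≃ₜ Cantor n) : Prop :=
  ∃ (l : ℕ) (η ρ : Fin l → List (Fin n)) (p : Fin l → T.Q)
      (f : Fin l → (Cantor n → Cantor n)),
    l % (n - 1) = 1 % (n - 1) ∧
    AntichainFam η ∧
    (∀ i, T.Induces (p i) (f i)) ∧
    (⋃ i, appendInf (ρ i) '' Set.range (f i)) = Set.univ ∧
    (∀ i j, i ≠ j →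
      Disjoint (appendInf (ρ i) '' Set.range (f i))
        (appendInf (ρ j) '' Set.range (f j))) ∧
    ∀ (i : Fin l) (χ : Cantor n), h (appendInf (η i) χ) = appendInf (ρ i) (f i χ)

/-- The group `𝓗(T)` generated by all completions of `T`. -/
def HGroup (T : Transducer n) : Subgroup (Cantor n ≃ₜ Cantor n) :=
  Subgroup.closure {h | T.IsCompletion h}

/-- The subgroup-generating equivalence relation induced by the automaton underlying a
transducer `A` with start state `a0` (by Lemma 4.1, two words are related iff the states
they reach are identified by the collapsing procedure, i.e. iff the reached states
transition identically on all sufficiently long words). -/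
def simA (A : Transducer n) (a0 : A.Q) (α β : List (Fin n)) : Prop :=
  ∃ i : ℕ, ∀ w : List (Fin n), w.length = i →
    A.transStar w (A.transStar α a0) = A.transStar w (A.transStar β a0)

/-- `if b then T else T'`. -/
def factor (T : Transducer n) (b : Bool) : Transducer n :=
  if b then T else T.partialInv

/-- The product of a nonempty list of factors, each equal to `T` or its partial
inverse `T'`; these products make up the set `Π(T)`. -/
def prodOf (T : Transducer n) : List Bool → Transducer n
  | [] => T
  | [b] => T.factor b
  | b :: c :: rest => (T.factor b).prod (T.prodOf (c :: rest))

/-- `T` is contracting: every state of every product of copies of `T` and `T'` is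
`ω`-equivalent to an initial transducer which, after reading some fixed length of input,
always acts as a state of `T`. -/
def Contracting (T : Transducer n) : Prop :=
  ∀ L : List Bool, L ≠ [] → ∀ q : (T.prodOf L).Q,
    ∃ (V : Transducer n) (p : V.Q) (f : Cantor n → Cantor n),
      (T.prodOf L).Induces q f ∧ V.Induces p f ∧
      ∃ j : ℕ, ∀ w : List (Fin n), w.length = j →
        ∃ (u : T.Q) (g : Cantor n → Cantor n),
          V.Induces (V.transStar w p) g ∧ T.Induces u g

end Transducer

/-- The element `v` of `Vₙ` preserves the relation `r` on nonempty finite words: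
whenever `v` replaces the prefix `α` by `β`, the words `α` and `β` are related. -/
def PreservesRel {n : ℕ} (r : List (Fin n) → List (Fin n) → Prop)
    (g : Cantor n ≃ₜ Cantor n) : Prop :=
  ∀ (α β : List (Fin n)), α ≠ [] → β ≠ [] →
    (∀ χ : Cantor n, g (appendInf α χ) = appendInf β χ) → r α β

/-- The subgroup `V_∼` of `Vₙ` generated by the prefix-exchange homeomorphisms
preserving the relation `r`. -/
def VSim (n : ℕ) (r : List (Fin n) → List (Fin n) → Prop) :
    Subgroup (Cantor n ≃ₜ Cantor n) :=
  Subgroup.closure {g | g ∈ Vn n ∧ PreservesRel r g}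

/-- `f` coincides with `g` on the cone `[α]` (conjugated into the cone) and is the
identity off the cone: the homeomorphism `[α]_g`. -/
def IsRestrTo {n : ℕ} (α : List (Fin n)) (g f : Cantor n ≃ₜ Cantor n) : Prop :=
  (∀ χ : Cantor n, f (appendInf α χ) = appendInf α (g χ)) ∧
  ∀ χ : Cantor n, ¬ PrefixOf α χ → f χ = χ

/-- The Nekrashevych group `Vₙ(G)`: the group generated by `Vₙ` together with all the
homeomorphisms `[α]_g` for `g ∈ G`. -/
def NekG (n : ℕ) (G : Subgroup (Cantor n ≃ₜ Cantor n)) :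
    Subgroup (Cantor n ≃ₜ Cantor n) :=
  Subgroup.closure (Vn n ∪ {f | ∃ (α : List (Fin n)) (g : Cantor n ≃ₜ Cantor n),
    g ∈ G ∧ IsRestrTo α g f})

/-- The homeomorphism `f` locally agrees with the set `G` of homeomorphisms. -/
def LocallyAgrees {n : ℕ} (G : Set (Cantor n ≃ₜ Cantor n))
    (f : Cantor n ≃ₜ Cantor n) : Prop :=
  ∀ x : Cantor n, ∃ U : Set (Cantor n), IsOpen U ∧ x ∈ U ∧
    ∃ g ∈ G, Set.EqOn ⇑f ⇑g U

/-- A finite synchronous invertible transducer over `Fin n`: each state rewrites single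
letters to single letters bijectively. -/
structure SyncTransducer (n : ℕ) where
  /-- the set of states -/
  Q : Type
  /-- there are finitely many states -/
  fin : Finite Q
  /-- the transition function -/
  tr : Fin n → Q → Q
  /-- the (single-letter) output function -/
  out : Fin n → Q → Fin n
  /-- each state rewrites letters bijectively -/
  bij : ∀ q : Q, Function.Bijective fun x => out x q

namespace SyncTransducer

variable {n : ℕ}

/-- The transition function extended to finite words. -/
def trStar (U : SyncTransducer n) : List (Fin n) → U.Q → U.Q
  | [], q => q
  | x :: w, q => U.trStar w (U.tr x q)

/-- The output function extended to finite words. -/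
def outWord (U : SyncTransducer n) : List (Fin n) → U.Q → List (Fin n)
  | [], _ => []
  | x :: w, q => U.out x q :: U.outWord w (U.tr x q)

/-- The map on Cantor space induced by the initial transducer `U_q`. -/
def applyFun (U : SyncTransducer n) (q : U.Q) (χ : Cantor n) : Cantor n :=
  fun i => U.out (χ i) (U.trStar (takeW χ i) q)

/-- The inverse transducer of a synchronous invertible transducer. -/
def inv (U : SyncTransducer n) : SyncTransducer n where
  Q := U.Q
  fin := U.fin
  tr := fun y q => U.tr ((Equiv.ofBijective _ (U.bij q)).symm y) q
  out := fun y q => (Equiv.ofBijective _ (U.bij q)).symm y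
  bij := fun q => (Equiv.ofBijective _ (U.bij q)).symm.bijective

/-- The product of synchronous transducers (first act by `T`, then by `S`). -/
def sprod (T S : SyncTransducer n) : SyncTransducer n where
  Q := T.Q × S.Q
  fin := by
    haveI := T.fin; haveI := S.fin
    infer_instance
  tr := fun x p => (T.tr x p.1, S.tr (T.out x p.1) p.2)
  out := fun x p => S.out (T.out x p.1) p.2
  bij := fun p => (S.bij p.2).comp (T.bij p.1)

/-- `U` is synchronizing at level `k`. -/
def SyncAtLevel (U : SyncTransducer n) (k : ℕ) : Prop :=
  ∀ w : List (Fin n), w.length = k → ∀ q q' : U.Q, U.trStar w q = U.trStar w q'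

/-- `U` is synchronizing. -/
def Synchronizing (U : SyncTransducer n) : Prop := ∃ k, U.SyncAtLevel k

/-- `U` is minimal (under `ω`-equivalence): distinct states induce distinct maps. -/
def Minimal (U : SyncTransducer n) : Prop :=
  ∀ q q' : U.Q, U.applyFun q = U.applyFun q' → q = q'

/-- One-way synchronizing: `U` is synchronizing but the inverse homeomorphism of
`h = U_{q0}` is not induced by any finite synchronizing transducer. -/
def OneWaySync (U : SyncTransducer n) (h : Cantor n ≃ₜ Cantor n) : Prop :=
  U.Synchronizing ∧
    ¬ ∃ (S : Transducer n) (_ : Finite S.Q) (s0 : S.Q),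
        S.Induces s0 ⇑h.symm ∧ S.Synchronizing

/-- `U` is equal to its core. -/
def EqualToCore (U : SyncTransducer n) : Prop :=
  ∀ k : ℕ, U.SyncAtLevel k → ∀ q : U.Q, ∃ (w : List (Fin n)) (p : U.Q),
    w.length = k ∧ U.trStar w p = q

/-- The underlying (asynchronous-format) transducer of a synchronous transducer. -/
def toT (U : SyncTransducer n) : Transducer n :=
  ⟨U.Q, U.tr, fun x q => [U.out x q]⟩

/-- The automaton group `𝒢(U)` generated by `U`: the subgroup of the homeomorphism
group of Cantor space generated by the homeomorphisms `U_q` for the states `q`. -/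
def autG (U : SyncTransducer n) : Subgroup (Cantor n ≃ₜ Cantor n) :=
  Subgroup.closure {f : Cantor n ≃ₜ Cantor n | ∃ q : U.Q, ⇑f = U.applyFun q}

end SyncTransducer

section FiniteWords

variable {n : ℕ}

/-- The infinite word obtained by deleting the first `k` letters. -/
def dropInf (k : ℕ) (χ : Cantor n) : Cantor n := fun i => χ (i + k)

theorem prefixOf_appendInf (w : List (Fin n)) (χ : Cantor n) : PrefixOf w (appendInf w χ) := by
  intro i h
  simp [appendInf, h]

theorem dropInf_appendInf (w : List (Fin n)) (χ : Cantor n) :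
    dropInf w.length (appendInf w χ) = χ := by
  funext i
  simp [dropInf, appendInf]

theorem PrefixOf.appendInf_dropInf {w : List (Fin n)} {χ : Cantor n} (h : PrefixOf w χ) :
    appendInf w (dropInf w.length χ) = χ := by
  funext i
  by_cases hi : i < w.length
  · simpa [appendInf, hi] using h i hi
  · simp [dropInf, appendInf, hi, Nat.sub_add_cancel (not_lt.1 hi)]

theorem appendInf_append (u v : List (Fin n)) (χ : Cantor n) :
    appendInf (u ++ v) χ = appendInf u (appendInf v χ) := by
  funext i
  simp only [appendInf, List.get_eq_getElem, List.length_append, List.getElem_append]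
  split_ifs <;> first | rfl | omega | (congr 1; omega)

theorem appendInf_injective (w : List (Fin n)) : Function.Injective (appendInf w) := fun χ ψ h => by
  rw [← dropInf_appendInf w χ, h, dropInf_appendInf]

theorem PrefixOf.of_append {u v : List (Fin n)} {χ : Cantor n} (h : PrefixOf (u ++ v) χ) :
    PrefixOf u χ := by
  rw [← h.appendInf_dropInf, appendInf_append]
  exact prefixOf_appendInf _ _

theorem prefixOf_append_iff {u v : List (Fin n)} {χ : Cantor n} :
    PrefixOf (u ++ v) (appendInf u χ) ↔ PrefixOf v χ := by
  constructor
  · intro h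
    have h' := h.appendInf_dropInf
    rw [appendInf_append] at h'
    rw [← appendInf_injective u h']
    exact prefixOf_appendInf _ _
  · intro h
    rw [← h.appendInf_dropInf, ← appendInf_append]
    exact prefixOf_appendInf _ _

theorem prefixOf_singleton_iff {x : Fin n} {χ : Cantor n} : PrefixOf [x] χ ↔ x = χ 0 := by
  constructor
  · intro h
    exact h 0 (by simp)
  · intro h i hi
    obtain rfl : i = 0 := by simpa using hi
    exact h

theorem prefixOf_append_singleton_iff {w : List (Fin n)} {x : Fin n} {χ : Cantor n} :
    PrefixOf (w ++ [x]) χ ↔ PrefixOf w χ ∧ x = dropInf w.length χ 0 := by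
  constructor
  · intro h
    have hw := h.of_append
    rw [← hw.appendInf_dropInf, prefixOf_append_iff, prefixOf_singleton_iff] at h
    exact ⟨hw, h⟩
  · rintro ⟨hw, hx⟩
    rw [← hw.appendInf_dropInf, prefixOf_append_iff, prefixOf_singleton_iff]
    exact hx

theorem takeW_appendInf_singleton (x : Fin n) (χ : Cantor n) (k : ℕ) :
    takeW (appendInf [x] χ) (k + 1) = x :: takeW χ k := by
  simp [takeW, List.ofFn_succ, appendInf]

theorem takeW_prefixOf_iff {χ ψ : Cantor n} {k : ℕ} :
    PrefixOf (takeW χ k) ψ ↔ ∀ i < k, χ i = ψ i := by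
  simp [PrefixOf, takeW]

theorem isOpen_cone (w : List (Fin n)) : IsOpen (cone w) := by
  have : cone w = ⋂ i : Fin w.length, (fun χ : Cantor n => χ i) ⁻¹' {w.get i} := by
    ext χ
    simp only [cone, PrefixOf, Set.mem_ofPred_eq, Set.mem_iInter, Set.mem_preimage,
      Set.mem_singleton_iff]
    exact ⟨fun h i => (h i i.2).symm, fun h i hi => (h ⟨i, hi⟩).symm⟩
  rw [this]
  exact isOpen_iInter_of_finite fun i => (isOpen_discrete _).preimage (continuous_apply _)

theorem exists_cone_subset {E : Set (Cantor n)} (hE : IsOpen E) (hne : E.Nonempty) :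
    ∃ w : List (Fin n), cone w ⊆ E := by
  obtain ⟨χ, hχ⟩ := hne
  obtain ⟨I, u, hu, hI⟩ := isOpen_pi_iff.1 hE χ hχ
  refine ⟨takeW χ (I.sup id + 1), fun ψ hψ => hI fun i hi => ?_⟩
  have hlt : i < I.sup id + 1 := Nat.lt_succ_of_le (Finset.le_sup (f := id) hi)
  rw [← takeW_prefixOf_iff.1 hψ i hlt]
  exact (hu i hi).2

theorem continuous_appendInf (w : List (Fin n)) : Continuous (appendInf w) := by
  refine continuous_pi fun i => ?_
  by_cases hi : i < w.length
  · simpa [appendInf, hi] using continuous_const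
  · simpa [appendInf, hi] using continuous_apply _

theorem continuous_dropInf (k : ℕ) : Continuous (dropInf k : Cantor n → Cantor n) :=
  continuous_pi fun i => continuous_apply (i + k)

end FiniteWords

section PrefixExchange

variable {n m : ℕ}

/-- The map replacing the prefix `α i` by `β i`. -/
def prefixExchange {α : Fin m → List (Fin n)} (hα : AntichainFam α) (β : Fin m → List (Fin n))
    (χ : Cantor n) : Cantor n :=
  appendInf (β (hα χ).choose) (dropInf (α (hα χ).choose).length χ)

theorem prefixExchange_of_prefixOf {α : Fin m → List (Fin n)} (hα : AntichainFam α)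
    (β : Fin m → List (Fin n)) {χ : Cantor n} {i : Fin m} (h : PrefixOf (α i) χ) :
    prefixExchange hα β χ = appendInf (β i) (dropInf (α i).length χ) := by
  rw [prefixExchange, ← (hα χ).choose_spec.2 i h]

theorem prefixExchange_appendInf {α : Fin m → List (Fin n)} (hα : AntichainFam α)
    (β : Fin m → List (Fin n)) (i : Fin m) (χ : Cantor n) :
    prefixExchange hα β (appendInf (α i) χ) = appendInf (β i) χ := by
  rw [prefixExchange_of_prefixOf hα β (prefixOf_appendInf _ _), dropInf_appendInf]

theorem continuous_prefixExchange {α : Fin m → List (Fin n)} (hα : AntichainFam α)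
    (β : Fin m → List (Fin n)) : Continuous (prefixExchange hα β) := by
  refine continuous_iff_continuousAt.2 fun χ => ?_
  obtain ⟨i, hi, -⟩ := hα χ
  refine ((continuous_appendInf (β i)).comp (continuous_dropInf (α i).length)).continuousAt.congr ?_
  filter_upwards [(isOpen_cone (α i)).mem_nhds hi] with ψ hψ
  exact (prefixExchange_of_prefixOf hα β hψ).symm

theorem prefixExchange_prefixExchange {α β : Fin m → List (Fin n)} (hα : AntichainFam α)
    (hβ : AntichainFam β) (χ : Cantor n) :
    prefixExchange hβ α (prefixExchange hα β χ) = χ := by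
  obtain ⟨i, hi, -⟩ := hα χ
  rw [prefixExchange_of_prefixOf hα β hi, prefixExchange_appendInf, hi.appendInf_dropInf]

/-- The prefix exchange homeomorphism between two maximal antichains. -/
def prefixExchangeHomeo {α β : Fin m → List (Fin n)} (hα : AntichainFam α)
    (hβ : AntichainFam β) : Cantor n ≃ₜ Cantor n where
  toFun := prefixExchange hα β
  invFun := prefixExchange hβ α
  left_inv := prefixExchange_prefixExchange hα hβ
  right_inv := prefixExchange_prefixExchange hβ hα
  continuous_toFun := continuous_prefixExchange hα β
  continuous_invFun := continuous_prefixExchange hβ α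

end PrefixExchange

section AntichainSets

variable {n : ℕ}

/-- A finite set of finite words forming a maximal antichain. -/
def IsAntichainSet (S : Finset (List (Fin n))) : Prop :=
  ∀ χ : Cantor n, ∃! w, w ∈ S ∧ PrefixOf w χ

theorem IsAntichainSet.antichainFam {m : ℕ} {S : Finset (List (Fin n))} (hS : IsAntichainSet S)
    (e : Fin m ≃ S) : AntichainFam fun i => (e i : List (Fin n)) := by
  intro χ
  obtain ⟨w, ⟨hw, hp⟩, hu⟩ := hS χ
  refine ⟨e.symm ⟨w, hw⟩, by simpa using hp, fun j hj => ?_⟩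
  rw [Equiv.eq_symm_apply]
  exact Subtype.ext (hu _ ⟨(e j).2, hj⟩)

theorem AntichainFam.injective [NeZero n] {m : ℕ} {α : Fin m → List (Fin n)}
    (hα : AntichainFam α) : Function.Injective α := by
  intro i j hij
  refine (hα (appendInf (α i) fun _ => 0)).unique (prefixOf_appendInf _ _) ?_
  rw [hij]
  exact prefixOf_appendInf _ _

theorem AntichainFam.isAntichainSet {m : ℕ} {α : Fin m → List (Fin n)} (hα : AntichainFam α) :
    IsAntichainSet (Finset.univ.image α) := by
  intro χ
  obtain ⟨i, hi, hu⟩ := hα χ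
  refine ⟨α i, ⟨by simp, hi⟩, ?_⟩
  rintro w ⟨hw, hp⟩
  obtain ⟨j, -, rfl⟩ := Finset.mem_image.1 hw
  rw [hu j hp]

/-- Replace the word `w` by its one-letter extensions. -/
def splitAt (S : Finset (List (Fin n))) (w : List (Fin n)) : Finset (List (Fin n)) :=
  S.erase w ∪ Finset.univ.image fun x : Fin n => w ++ [x]

theorem mem_splitAt {S : Finset (List (Fin n))} {w u : List (Fin n)} :
    u ∈ splitAt S w ↔ (u ≠ w ∧ u ∈ S) ∨ ∃ x, w ++ [x] = u := by
  simp [splitAt]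

theorem IsAntichainSet.splitAt {S : Finset (List (Fin n))} (hS : IsAntichainSet S)
    {w : List (Fin n)} (hw : w ∈ S) : IsAntichainSet (splitAt S w) := by
  intro χ
  obtain ⟨u, ⟨huS, hu⟩, huu⟩ := hS χ
  by_cases huw : u = w
  · subst huw
    refine ⟨u ++ [dropInf u.length χ 0],
      ⟨mem_splitAt.2 (.inr ⟨_, rfl⟩), prefixOf_append_singleton_iff.2 ⟨hu, rfl⟩⟩, ?_⟩
    rintro v ⟨hv, hvp⟩
    obtain ⟨hne, hvS⟩ | ⟨x, rfl⟩ := mem_splitAt.1 hv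
    · exact absurd (huu v ⟨hvS, hvp⟩) hne
    · rw [(prefixOf_append_singleton_iff.1 hvp).2]
  · refine ⟨u, ⟨mem_splitAt.2 (.inl ⟨huw, huS⟩), hu⟩, ?_⟩
    rintro v ⟨hv, hvp⟩
    obtain ⟨hne, hvS⟩ | ⟨x, rfl⟩ := mem_splitAt.1 hv
    · exact huu v ⟨hvS, hvp⟩
    · exact absurd (huu w ⟨hw, hvp.of_append⟩).symm huw

theorem IsAntichainSet.card_splitAt [NeZero n] {S : Finset (List (Fin n))}
    (hS : IsAntichainSet S) {w : List (Fin n)} (hw : w ∈ S) :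
    (_root_.splitAt S w).card = S.card + (n - 1) := by
  have hdisj : Disjoint (S.erase w) (Finset.univ.image fun x : Fin n => w ++ [x]) := by
    rw [Finset.disjoint_left]
    intro u hu hu'
    obtain ⟨x, -, rfl⟩ := Finset.mem_image.1 hu'
    have hp := prefixOf_appendInf (w ++ [x]) fun _ => 0
    have := (hS _).unique ⟨Finset.mem_of_mem_erase hu, hp⟩ ⟨hw, hp.of_append⟩
    simp at this
  have hinj : Function.Injective fun x : Fin n => w ++ [x] := fun x y h => by simpa using h
  have hpos := Finset.card_pos.2 ⟨w, hw⟩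
  have hn := NeZero.pos n
  rw [_root_.splitAt, Finset.card_union_of_disjoint hdisj, Finset.card_erase_of_mem hw,
    Finset.card_image_of_injective _ hinj, Finset.card_univ, Fintype.card_fin]
  omega

theorem isAntichainSet_singleton_nil : IsAntichainSet ({[]} : Finset (List (Fin n))) := fun χ =>
  ⟨[], ⟨by simp, fun i hi => absurd hi (by simp)⟩, fun w hw => by simpa using hw.1⟩

theorem exists_isAntichainSet_mem [NeZero n] (w : List (Fin n)) :
    ∃ S : Finset (List (Fin n)), IsAntichainSet S ∧ w ∈ S ∧ S.card = 1 + w.length * (n - 1) := by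
  induction w using List.reverseRecOn with
  | nil => exact ⟨{[]}, isAntichainSet_singleton_nil, by simp, by simp⟩
  | append_singleton w x ih =>
    obtain ⟨S, hS, hw, hcard⟩ := ih
    refine ⟨splitAt S w, hS.splitAt hw, mem_splitAt.2 (.inr ⟨x, rfl⟩), ?_⟩
    rw [hS.card_splitAt hw, hcard, List.length_append, List.length_singleton]
    ring

/-- A maximal antichain can be enlarged by `k * (n - 1)` words by refining only below a chosen
word. -/
theorem IsAntichainSet.exists_refine [NeZero n] {S : Finset (List (Fin n))}
    (hS : IsAntichainSet S) {w : List (Fin n)} (hw : w ∈ S) (k : ℕ) :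
    ∃ S' : Finset (List (Fin n)), IsAntichainSet S' ∧ S'.card = S.card + k * (n - 1) ∧
      (∀ u ∈ S', u ∈ S.erase w ∨ w <+: u) ∧ ∃ u ∈ S', w <+: u := by
  induction k with
  | zero =>
    refine ⟨S, hS, by simp, fun u hu => ?_, w, hw, List.prefix_rfl⟩
    by_cases h : u = w
    · exact .inr (h ▸ List.prefix_rfl)
    · exact .inl (Finset.mem_erase.2 ⟨h, hu⟩)
  | succ k ih =>
    obtain ⟨S', hS', hcard, hmem, u, hu, hwu⟩ := ih
    refine ⟨_root_.splitAt S' u, hS'.splitAt hu, ?_, fun v hv => ?_, u ++ [0],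
      mem_splitAt.2 (.inr ⟨0, rfl⟩), hwu.trans (List.prefix_append _ _)⟩
    · rw [hS'.card_splitAt hu, hcard]
      ring
    · obtain ⟨-, hv⟩ | ⟨x, rfl⟩ := mem_splitAt.1 hv
      · exact hmem v hv
      · exact .inr (hwu.trans (List.prefix_append _ _))

end AntichainSets

namespace Transducer

variable {n : ℕ} {T : Transducer n}

theorem Induces.exists_letter {q : T.Q} {f : Cantor n → Cantor n} (hf : T.Induces q f)
    (x : Fin n) : ∃ g : Cantor n → Cantor n, T.Induces (T.tr x q) g ∧
      ∀ χ, f (appendInf [x] χ) = appendInf (T.out x q) (g χ) := by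
  have key (χ : Cantor n) (m : ℕ) : ∃ k, m ≤ (T.outStar (takeW χ k) (T.tr x q)).length ∧
      PrefixOf (T.out x q ++ T.outStar (takeW χ k) (T.tr x q)) (f (appendInf [x] χ)) := by
    obtain ⟨k, hk, hp⟩ := hf (appendInf [x] χ) (m + (T.out x q).length + 1)
    cases k with
    | zero => simp [takeW, outStar] at hk
    | succ k =>
      rw [takeW_appendInf_singleton] at hk hp
      refine ⟨k, ?_, hp⟩
      rw [outStar, List.length_append] at hk
      omega
  have hout (χ : Cantor n) : f (appendInf [x] χ) = appendInf (T.out x q)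
      (dropInf (T.out x q).length (f (appendInf [x] χ))) := by
    obtain ⟨k, -, hp⟩ := key χ 0
    exact hp.of_append.appendInf_dropInf.symm
  refine ⟨fun χ => dropInf (T.out x q).length (f (appendInf [x] χ)), fun χ m => ?_, hout⟩
  obtain ⟨k, hk, hp⟩ := key χ m
  rw [hout χ, prefixOf_append_iff] at hp
  exact ⟨k, hk, hp⟩

/-- On the cone of `w`, the map `h` acts as a state of `T`, up to a change of prefix. -/
def ActsOnCone (T : Transducer n) (h : Cantor n → Cantor n) (w : List (Fin n)) : Prop :=
  ∃ (ρ : List (Fin n)) (p : T.Q) (f : Cantor n → Cantor n), T.Induces p f ∧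
    ∀ χ, h (appendInf w χ) = appendInf ρ (f χ)

theorem ActsOnCone.append_singleton {h : Cantor n → Cantor n} {w : List (Fin n)}
    (hw : T.ActsOnCone h w) (x : Fin n) : T.ActsOnCone h (w ++ [x]) := by
  obtain ⟨ρ, p, f, hf, hh⟩ := hw
  obtain ⟨g, hg, hfg⟩ := hf.exists_letter x
  exact ⟨ρ ++ T.out x p, T.tr x p, g, hg, fun χ => by
    rw [appendInf_append, hh, hfg, appendInf_append]⟩

theorem ActsOnCone.of_prefix {h : Cantor n → Cantor n} {w u : List (Fin n)}
    (hw : T.ActsOnCone h w) (hwu : w <+: u) : T.ActsOnCone h u := by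
  obtain ⟨v, rfl⟩ := hwu
  induction v using List.reverseRecOn with
  | nil => simpa using hw
  | append_singleton v x ih => simpa using ih.append_singleton x

theorem isCompletion_of_actsOnCone {l : ℕ} {η : Fin l → List (Fin n)} {h : Cantor n ≃ₜ Cantor n}
    (hl : l % (n - 1) = 1 % (n - 1)) (hη : AntichainFam η) (hh : ∀ i, T.ActsOnCone h (η i)) :
    T.IsCompletion h := by
  choose ρ p f hf hρ using hh
  refine ⟨l, η, ρ, p, f, hl, hη, hf, ?_, fun i j hij => ?_, hρ⟩
  · refine Set.eq_univ_of_forall fun y => ?_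
    obtain ⟨i, hi, -⟩ := hη (h.symm y)
    refine Set.mem_iUnion.2 ⟨i, _, ⟨dropInf (η i).length (h.symm y), rfl⟩, ?_⟩
    rw [← hρ, hi.appendInf_dropInf, h.apply_symm_apply]
  · rw [Set.disjoint_left]
    rintro _ ⟨_, ⟨χ, rfl⟩, rfl⟩ ⟨_, ⟨ψ, rfl⟩, hψ⟩
    rw [← hρ, ← hρ] at hψ
    refine hij ((hη (appendInf (η i) χ)).unique (prefixOf_appendInf _ _) ?_)
    rw [← h.injective hψ]
    exact prefixOf_appendInf _ _

theorem exists_isCompletion_prefixExchange {m : ℕ} {α η : Fin m → List (Fin n)}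
    {h : Cantor n ≃ₜ Cantor n} (hm : m % (n - 1) = 1 % (n - 1)) (hα : AntichainFam α)
    (hη : AntichainFam η) (hh : ∀ i, T.ActsOnCone h (η i)) :
    ∃ g : Cantor n ≃ₜ Cantor n, T.IsCompletion g ∧
      ∀ i χ, g (appendInf (α i) χ) = h (appendInf (η i) χ) := by
  have hg (i χ) : ((prefixExchangeHomeo hα hη).trans h) (appendInf (α i) χ) =
      h (appendInf (η i) χ) := congrArg h (prefixExchange_appendInf hα η i χ)
  refine ⟨_, isCompletion_of_actsOnCone hm hα fun i => ?_, hg⟩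
  obtain ⟨ρ, p, f, hf, hρ⟩ := hh i
  exact ⟨ρ, p, f, hf, fun χ => (hg i χ).trans (hρ χ)⟩

theorem exists_mem_HGroup_prefixExchange {m : ℕ} {α β η : Fin m → List (Fin n)}
    {h : Cantor n ≃ₜ Cantor n} (hm : m % (n - 1) = 1 % (n - 1)) (hα : AntichainFam α)
    (hβ : AntichainFam β) (hη : AntichainFam η) (hh : ∀ i, T.ActsOnCone h (η i)) :
    ∃ v ∈ HGroup T, ∀ i χ, v (appendInf (α i) χ) = appendInf (β i) χ := by
  obtain ⟨g₁, hg₁, h₁⟩ := exists_isCompletion_prefixExchange hm hα hη hh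
  obtain ⟨g₂, hg₂, h₂⟩ := exists_isCompletion_prefixExchange hm hβ hη hh
  refine ⟨g₂⁻¹ * g₁, mul_mem (inv_mem (Subgroup.subset_closure hg₂))
    (Subgroup.subset_closure hg₁), fun i χ => ?_⟩
  change g₂.symm (g₁ (appendInf (α i) χ)) = _
  rw [h₁, ← h₂, g₂.symm_apply_apply]

/-- A completion acts by states of `T` on the cones of arbitrarily large maximal antichains. -/
theorem IsCompletion.exists_actsOnCone [NeZero n] {h : Cantor n ≃ₜ Cantor n}
    (hh : T.IsCompletion h) : ∃ c, ∀ k, ∃ S : Finset (List (Fin n)), IsAntichainSet S ∧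
      S.card = 1 + (c + k) * (n - 1) ∧ ∀ w ∈ S, T.ActsOnCone h w := by
  obtain ⟨l, η, ρ, p, f, hl, hη, hf, -, -, hρ⟩ := hh
  obtain ⟨i₀, -, -⟩ := hη fun _ => 0
  have hpos : 1 ≤ l := i₀.pos
  obtain ⟨c, hc⟩ := (Nat.modEq_iff_dvd' hpos).1 (Eq.symm hl : 1 ≡ l [MOD n - 1])
  refine ⟨c, fun k => ?_⟩
  have hη' (w) (hw : w ∈ Finset.univ.image η) : T.ActsOnCone h w := by
    obtain ⟨i, -, rfl⟩ := Finset.mem_image.1 hw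
    exact ⟨ρ i, p i, f i, hf i, hρ i⟩
  have hi₀ : η i₀ ∈ Finset.univ.image η := by simp
  obtain ⟨S, hS, hcard, hmem, -⟩ := hη.isAntichainSet.exists_refine hi₀ k
  refine ⟨S, hS, ?_, fun w hw => ?_⟩
  · rw [hcard, Finset.card_image_of_injective _ hη.injective, Finset.card_univ, Fintype.card_fin,
      add_mul, mul_comm c, ← hc]
    omega
  · obtain hw | hw := hmem w hw
    · exact hη' w (Finset.mem_of_mem_erase hw)
    · exact (hη' _ hi₀).of_prefix hw

/-- The complement of any cone can be moved into any cone by an element of `HGroup T`. -/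
theorem IsCompletion.exists_mem_HGroup_mapsTo [NeZero n] {h : Cantor n ≃ₜ Cantor n}
    (hh : T.IsCompletion h) (w₁ w₂ : List (Fin n)) :
    ∃ v ∈ HGroup T, Set.MapsTo v (cone w₁)ᶜ (cone w₂) := by
  obtain ⟨c, hc⟩ := hh.exists_actsOnCone
  obtain ⟨S₁, hS₁, hw₁, hcard₁⟩ := exists_isAntichainSet_mem w₁
  obtain ⟨S₂, hS₂, hw₂, hcard₂⟩ := exists_isAntichainSet_mem w₂
  obtain ⟨S₁', hS₁', hcard₁', hmem₁, -⟩ := hS₁.exists_refine hw₁ (c + w₂.length)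
  obtain ⟨S₂', hS₂', hcard₂', hmem₂, -⟩ := hS₂.exists_refine hw₂ (c + w₁.length)
  obtain ⟨S, hS, hcard, hact⟩ := hc (w₁.length + w₂.length)
  have h₁ : S.card = S₁'.card := by rw [hcard, hcard₁', hcard₁]; ring
  have h₂ : S₁'.card = S₂'.card := by rw [← h₁, hcard, hcard₂', hcard₂]; ring
  let A : Finset S₁' := Finset.univ.filter fun u => ¬ w₁ <+: (u : List (Fin n))
  let B : Finset (List (Fin n)) := S₂'.filter fun u => w₂ <+: u
  have hA : A.card ≤ w₁.length * (n - 1) := by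
    have hle : A.card ≤ (S₁.erase w₁).card := by
      refine Finset.card_le_card_of_injOn Subtype.val (fun u hu => ?_)
        Subtype.val_injective.injOn
      exact (hmem₁ u u.2).resolve_right (Finset.mem_filter.1 hu).2
    rw [Finset.card_erase_of_mem hw₁, hcard₁] at hle
    omega
  have hB : A.card ≤ B.card := by
    have hle : S₂'.card ≤ ((S₂.erase w₂) ∪ B).card := Finset.card_le_card fun u hu =>
      Finset.mem_union.2 ((hmem₂ u hu).imp_right fun h => Finset.mem_filter.2 ⟨hu, h⟩)
    have := hle.trans (Finset.card_union_le _ _)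
    rw [Finset.card_erase_of_mem hw₂, hcard₂', hcard₂, add_mul] at this
    omega
  obtain ⟨f, hfB, hf⟩ : ∃ f : S₁' → List (Fin n), A.image f ⊆ B ∧ Set.InjOn f A := by
    obtain ⟨g⟩ := Function.Embedding.nonempty_of_card_le (α := A) (β := B) (by simpa using hB)
    refine ⟨fun u => if hu : u ∈ A then g ⟨u, hu⟩ else [], ?_, fun u hu u' hu' h => ?_⟩
    · refine Finset.image_subset_iff.2 fun u hu => ?_
      rw [dif_pos hu]
      exact (g ⟨u, hu⟩).2
    · simp only [dif_pos (Finset.mem_coe.1 hu), dif_pos (Finset.mem_coe.1 hu')] at h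
      exact congrArg Subtype.val (g.injective (Subtype.ext h))
  obtain ⟨e, he⟩ := Finset.exists_equiv_extend_of_card_eq (t := S₂')
    (by simpa using h₂) (hfB.trans (Finset.filter_subset _ _)) hf
  let e₀ : Fin S.card ≃ S := S.equivFin.symm
  let e₁ : Fin S.card ≃ S₁' := (finCongr h₁).trans S₁'.equivFin.symm
  obtain ⟨v, hv, hve⟩ := exists_mem_HGroup_prefixExchange (T := T) (h := h)
    (by rw [hcard]; simp) (hS₁'.antichainFam e₁) (hS₂'.antichainFam (e₁.trans e))
    (hS.antichainFam e₀) fun i => hact _ (e₀ i).2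
  refine ⟨v, hv, fun χ hχ => ?_⟩
  obtain ⟨u, ⟨hu, hp⟩, -⟩ := hS₁' χ
  have huA : (⟨u, hu⟩ : S₁') ∈ A := Finset.mem_filter.2 ⟨Finset.mem_univ _, fun hpre => by
    obtain ⟨t, rfl⟩ := hpre
    exact hχ hp.of_append⟩
  have hvχ := hve (e₁.symm ⟨u, hu⟩) (dropInf u.length χ)
  simp only [Equiv.trans_apply, Equiv.apply_symm_apply, hp.appendInf_dropInf, he _ huA] at hvχ
  obtain ⟨t, ht⟩ := (Finset.mem_filter.1 (hfB (Finset.mem_image_of_mem f huA))).2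
  change PrefixOf w₂ (v χ)
  rw [hvχ, ← ht, appendInf_append]
  exact prefixOf_appendInf _ _

end Transducer

/-- Proposition 6.7. Let `T ∈ 𝔓ₙ` have at least one completion in
the homeomorphism group of Cantor space.  Then `𝓗(T)` is flexible: for every pair
`E₁, E₂` of proper nonempty clopen subsets of Cantor space there is `f ∈ 𝓗(T)` with
`(E₁)f ⊂ E₂`. -/
theorem HGroup_is_flexible
    {n : ℕ} (hn : 2 ≤ n) (T : Transducer n) [Finite T.Q]
    (hPI : T.PartiallyInvertible)
    (hex : ∃ h : Cantor n ≃ₜ Cantor n, T.IsCompletion h) :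
    ∀ E1 E2 : Set (Cantor n), IsClopen E1 → IsClopen E2 →
      E1.Nonempty → E2.Nonempty → E1 ≠ Set.univ → E2 ≠ Set.univ →
      ∃ f ∈ Transducer.HGroup T, ⇑f '' E1 ⊂ E2 := by
  intro E1 E2 hE1 hE2 _ hne2 hE1u _
  have : NeZero n := ⟨by omega⟩
  obtain ⟨h, hh⟩ := hex
  obtain ⟨w₁, hw₁⟩ := exists_cone_subset hE1.compl.isOpen (Set.nonempty_compl.2 hE1u)
  obtain ⟨w₂, hw₂⟩ := exists_cone_subset hE2.isOpen hne2
  obtain ⟨v, hv, hmaps⟩ := hh.exists_mem_HGroup_mapsTo w₁ (w₂ ++ [⟨0, by omega⟩])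
  have hsub : v '' E1 ⊆ cone (w₂ ++ [⟨0, by omega⟩]) :=
    (hmaps.mono_left (Set.subset_compl_comm.1 hw₁)).image_subset
  refine ⟨v, hv, fun y hy => hw₂ (hsub hy).of_append, fun hcontra => ?_⟩
  have hmem := hsub (hcontra (hw₂ (prefixOf_appendInf w₂ fun _ => ⟨1, by omega⟩)))
  have := prefixOf_singleton_iff.1 (prefixOf_append_iff.1 hmem)
  simp at this
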